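/- Let k be a field of characteristic p > 0 and let F₁ = k((u))((t)) and F₂ = k((t))((u)), with the pairings ( , | ]₁ and ( , | ]₂ defined as: (α,β|h]₁ := c_{−1,−1}( h·(α^{−1}∂_u α·β^{−1}∂_t β − α^{−1}∂_t α·β^{−1}∂_u β) ) on F₁ and (α,β|h]₂ := c'_{−1,−1}( h·(α^{−1}∂_t α·β^{−1}∂_u β − α^{−1}∂_u α·β^{−1}∂_t β) ) on F₂. Let i, j ≥ 1 be integers with p ∤ i and p ∤ j, let a, b, c ∈ k, let k₀, l₀ ∈ ℤ, and put z = c·u^{k₀}t^{l₀}. Then (1+a·u^i t^j, t | z]₁ + (1+b·u^i t^j, u | z]₂ equals c·(i·a + j·b) if k₀ = −i and l₀ = −j, and equals 0 if i+k₀ > 0 and j+l₀ > 0. (Integers act on k via the natural ring map ℤ → k.) -/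

import Mathlib

/-- Formal derivative on Laurent series: `(lsDeriv f).coeff n = (n+1) • f.coeff (n+1)`;
this is the formal derivative with respect to the outer variable of `k((u))((t))`. -/
noncomputable def lsDeriv {R : Type*} [AddCommGroup R] (f : LaurentSeries R) : LaurentSeries R :=
  HahnSeries.ofSuppBddBelow (fun n => (n + 1) • f.coeff (n + 1))
    (HahnSeries.forallLTEqZero_supp_BddBelow _ (f.order - 1)
      (fun _ hm => by rw [HahnSeries.coeff_eq_zero_of_lt_order (by omega), smul_zero]))

theorem lsDeriv_zero {R : Type*} [AddCommGroup R] : lsDeriv (0 : LaurentSeries R) = 0 := by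
  ext n; simp [lsDeriv]

/-- The formal partial derivative with respect to the inner variable of an iterated
Laurent series field, acting coefficientwise. -/
noncomputable def llDerivInner {k : Type*} [AddCommGroup k]
    (f : LaurentSeries (LaurentSeries k)) : LaurentSeries (LaurentSeries k) where
  coeff := fun b => lsDeriv (f.coeff b)
  isPWO_support' := f.isPWO_support.mono (fun b hb => by
    simp only [Function.mem_support] at hb ⊢
    exact fun h0 => hb (by rw [h0, lsDeriv_zero]))

/-- The length-one Witt (residue) pairing of a two-dimensional local field of iterated
Laurent series, with respect to (inner, outer) local parameters:
`(α,β|h] = c_{-1,-1}(h·(α⁻¹·∂_in α·β⁻¹·∂_out β − α⁻¹·∂_out α·β⁻¹·∂_in β))`.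
For `F₁ = k((u))((t))` (inner `u`, outer `t`) this is `( , | ]₁`; for
`F₂ = k((t))((u))` (inner `t`, outer `u`) this is `( , | ]₂`, whose sign reflects the
ordering `dt ∧ du`. -/
noncomputable def wittPair {k : Type*} [Field k]
    (α β h : LaurentSeries (LaurentSeries k)) : k :=
  ((h * (α⁻¹ * llDerivInner α * (β⁻¹ * lsDeriv β) -
      α⁻¹ * lsDeriv α * (β⁻¹ * llDerivInner β))).coeff (-1)).coeff (-1)

theorem lsDeriv_coeff {R : Type*} [AddCommGroup R] (f : LaurentSeries R) (n : ℤ) :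
    (lsDeriv f).coeff n = (n + 1) • f.coeff (n + 1) := rfl

theorem llDerivInner_coeff {k : Type*} [AddCommGroup k] (f : LaurentSeries (LaurentSeries k))
    (n : ℤ) : (llDerivInner f).coeff n = lsDeriv (f.coeff n) := rfl

theorem lsDeriv_add {R : Type*} [AddCommGroup R] (f g : LaurentSeries R) :
    lsDeriv (f + g) = lsDeriv f + lsDeriv g := by
  ext n
  simp [lsDeriv_coeff]

theorem lsDeriv_single {R : Type*} [AddCommGroup R] (n : ℤ) (r : R) :
    lsDeriv (HahnSeries.single n r) = HahnSeries.single (n - 1) (n • r) := by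
  ext m
  rw [lsDeriv_coeff]
  by_cases h : m = n - 1
  · subst h
    simp
  · rw [HahnSeries.coeff_single_of_ne h, HahnSeries.coeff_single_of_ne (by omega), smul_zero]

theorem lsDeriv_one {R : Type*} [Ring R] : lsDeriv (1 : LaurentSeries R) = 0 := by
  rw [← HahnSeries.single_zero_one, lsDeriv_single, zero_smul, HahnSeries.single_eq_zero]

theorem llDerivInner_add {k : Type*} [AddCommGroup k] (f g : LaurentSeries (LaurentSeries k)) :
    llDerivInner (f + g) = llDerivInner f + llDerivInner g := by
  ext1
  funext n
  simp only [llDerivInner_coeff, HahnSeries.coeff_add, lsDeriv_add]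

theorem llDerivInner_single {k : Type*} [AddCommGroup k] (n : ℤ) (f : LaurentSeries k) :
    llDerivInner (HahnSeries.single n f) = HahnSeries.single n (lsDeriv f) := by
  ext1
  funext m
  rw [llDerivInner_coeff]
  by_cases h : m = n
  · subst h
    simp
  · rw [HahnSeries.coeff_single_of_ne h, HahnSeries.coeff_single_of_ne h, lsDeriv_zero]

theorem llDerivInner_one {k : Type*} [Ring k] :
    llDerivInner (1 : LaurentSeries (LaurentSeries k)) = 0 := by
  rw [← HahnSeries.single_zero_one, llDerivInner_single, lsDeriv_one, HahnSeries.single_eq_zero]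

/-- The inverse of `1 + a x^m y^n` is an iterated power series in `y` over `k[[x]]` with constant
coefficient `1`. -/
theorem exists_powerSeries_inv {k : Type*} [Field k] (m n : ℕ) (hn : 1 ≤ n) (a : k) :
    ∃ P : PowerSeries (PowerSeries k), PowerSeries.constantCoeff P = 1 ∧
      (1 + HahnSeries.single (n : ℤ) (HahnSeries.single (m : ℤ) a))⁻¹ =
        HahnSeries.ofPowerSeries ℤ (LaurentSeries k)
          (PowerSeries.map (HahnSeries.ofPowerSeries ℤ k) P) := by
  set A : PowerSeries (PowerSeries k) :=
    1 + PowerSeries.C (PowerSeries.C a * PowerSeries.X ^ m) * PowerSeries.X ^ n with hA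
  have hA0 : PowerSeries.constantCoeff A = 1 := by
    simp [hA, show n ≠ 0 by omega]
  obtain ⟨P, hP⟩ : ∃ P, A * P = 1 :=
    ((PowerSeries.isUnit_iff_constantCoeff).2 (by rw [hA0]; exact isUnit_one)).exists_right_inv
  refine ⟨P, by simpa [hA0] using congrArg PowerSeries.constantCoeff hP, ?_⟩
  refine inv_eq_of_mul_eq_one_right ?_
  have h := congrArg (fun Q => HahnSeries.ofPowerSeries ℤ (LaurentSeries k)
    (PowerSeries.map (HahnSeries.ofPowerSeries ℤ k) Q)) hP
  simpa [hA, HahnSeries.ofPowerSeries_X_pow, HahnSeries.ofPowerSeries_C, HahnSeries.C_apply,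
    HahnSeries.single_mul_single] using h

theorem exists_wittPair_eq {k : Type*} [Field k] (m n : ℕ) (hn : 1 ≤ n) (a : k) :
    ∃ P : PowerSeries (PowerSeries k), PowerSeries.constantCoeff P = 1 ∧
      ∀ (r s : ℤ) (c : k),
        wittPair (1 + HahnSeries.single (n : ℤ) (HahnSeries.single (m : ℤ) a))
          (HahnSeries.single (1 : ℤ) (1 : LaurentSeries k))
          (HahnSeries.single s (HahnSeries.single r c)) =
        ((HahnSeries.ofPowerSeries ℤ (LaurentSeries k)
          (PowerSeries.map (HahnSeries.ofPowerSeries ℤ k) P)).coeff (-(n + s))).coeff (-(m + r)) *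
            (c * (m * a)) := by
  obtain ⟨P, hP, hinv⟩ := exists_powerSeries_inv m n hn a
  refine ⟨P, hP, fun r s c => ?_⟩
  rw [wittPair, hinv]
  set F := HahnSeries.ofPowerSeries ℤ (LaurentSeries k)
    (PowerSeries.map (HahnSeries.ofPowerSeries ℤ k) P)
  have key : HahnSeries.single s (HahnSeries.single r c) *
      (F * llDerivInner (1 + HahnSeries.single (n : ℤ) (HahnSeries.single (m : ℤ) a)) *
        ((HahnSeries.single (1 : ℤ) (1 : LaurentSeries k))⁻¹ *
          lsDeriv (HahnSeries.single (1 : ℤ) (1 : LaurentSeries k))) -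
      F * lsDeriv (1 + HahnSeries.single (n : ℤ) (HahnSeries.single (m : ℤ) a)) *
        ((HahnSeries.single (1 : ℤ) (1 : LaurentSeries k))⁻¹ *
          llDerivInner (HahnSeries.single (1 : ℤ) (1 : LaurentSeries k)))) =
      F * HahnSeries.single (s + (n - 1)) (HahnSeries.single (r + (m - 1)) (c * (m * a))) := by
    rw [llDerivInner_add, llDerivInner_one, llDerivInner_single, llDerivInner_single,
      lsDeriv_single, lsDeriv_single, lsDeriv_one, HahnSeries.single_eq_zero, mul_zero, mul_zero,
      sub_zero, zero_add, HahnSeries.inv_single, HahnSeries.single_mul_single, mul_assoc,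
      HahnSeries.single_mul_single, mul_left_comm, HahnSeries.single_mul_single]
    simp [HahnSeries.single_mul_single, sub_eq_add_neg]
  rw [key, show (-1 : ℤ) = -(n + s) + (s + (n - 1)) by ring, HahnSeries.coeff_mul_single_add,
    show -(n + s) + (s + (n - 1)) = -(m + r) + (r + (m - 1) : ℤ) by ring,
    HahnSeries.coeff_mul_single_add]

theorem wittPair_one_add_single_eq {k : Type*} [Field k] (m n : ℕ) (hn : 1 ≤ n) (a c : k) :
    wittPair (1 + HahnSeries.single (n : ℤ) (HahnSeries.single (m : ℤ) a))
      (HahnSeries.single (1 : ℤ) (1 : LaurentSeries k))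
      (HahnSeries.single (-n : ℤ) (HahnSeries.single (-m : ℤ) c)) = c * (m * a) := by
  obtain ⟨P, hP, h⟩ := exists_wittPair_eq m n hn a
  have h0 := HahnSeries.ofPowerSeries_apply_coeff (Γ := ℤ)
    (PowerSeries.map (HahnSeries.ofPowerSeries ℤ k) P) 0
  rw [PowerSeries.coeff_map, PowerSeries.coeff_zero_eq_constantCoeff_apply, hP, map_one,
    Nat.cast_zero] at h0
  rw [h, add_neg_cancel, add_neg_cancel, neg_zero, h0, HahnSeries.coeff_one, if_pos rfl, one_mul]

theorem wittPair_one_add_single_eq_zero {k : Type*} [Field k] (m n : ℕ) (hn : 1 ≤ n) (a c : k)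
    (r s : ℤ) (hs : 0 < n + s) :
    wittPair (1 + HahnSeries.single (n : ℤ) (HahnSeries.single (m : ℤ) a))
      (HahnSeries.single (1 : ℤ) (1 : LaurentSeries k))
      (HahnSeries.single s (HahnSeries.single r c)) = 0 := by
  obtain ⟨P, -, h⟩ := exists_wittPair_eq m n hn a
  have h0 : (HahnSeries.ofPowerSeries ℤ (LaurentSeries k)
      (PowerSeries.map (HahnSeries.ofPowerSeries ℤ k) P)).coeff (-(n + s)) = 0 := by
    rw [HahnSeries.ofPowerSeries_apply]
    refine HahnSeries.embDomain_of_notMem_range ?_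
    rintro ⟨q, hq⟩
    have hq' : (q : ℤ) = -(n + s) := hq
    omega
  rw [h, h0, HahnSeries.coeff_zero, zero_mul]

/-- with `F₁ = k((u))((t))` and `F₂ = k((t))((u))`, `p ∤ i`, `p ∤ j` and
`z = c·u^{k₀}t^{l₀}`, the sum `(1+a·u^i t^j, t | z]₁ + (1+b·u^i t^j, u | z]₂` equals
`c·(i·a + j·b)` if `k₀ = -i, l₀ = -j`, and `0` if `i+k₀ > 0` and `j+l₀ > 0`.
In `F₁` the element `u^{k₀}t^{l₀}` is `HahnSeries.single l₀ (HahnSeries.single k₀ 1)`,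
in `F₂` it is `HahnSeries.single k₀ (HahnSeries.single l₀ 1)`. -/
theorem witt_pairing_point_case_two
    (p : ℕ) (hp : p.Prime) (k : Type*) [Field k] [CharP k p]
    (i j : ℕ) (hi : 1 ≤ i) (hj : 1 ≤ j) (hpi : ¬ p ∣ i) (hpj : ¬ p ∣ j)
    (a b c : k) (k₀ l₀ : ℤ) :
    ((k₀ = -(i : ℤ) ∧ l₀ = -(j : ℤ)) →
      wittPair (1 + HahnSeries.single (j : ℤ) (HahnSeries.single (i : ℤ) a))
          (HahnSeries.single (1 : ℤ) (1 : LaurentSeries k))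
          (HahnSeries.single l₀ (HahnSeries.single k₀ c)) +
        wittPair (1 + HahnSeries.single (i : ℤ) (HahnSeries.single (j : ℤ) b))
          (HahnSeries.single (1 : ℤ) (1 : LaurentSeries k))
          (HahnSeries.single k₀ (HahnSeries.single l₀ c))
        = c * ((i : k) * a + (j : k) * b)) ∧
    ((0 < (i : ℤ) + k₀ ∧ 0 < (j : ℤ) + l₀) →
      wittPair (1 + HahnSeries.single (j : ℤ) (HahnSeries.single (i : ℤ) a))
          (HahnSeries.single (1 : ℤ) (1 : LaurentSeries k))
          (HahnSeries.single l₀ (HahnSeries.single k₀ c)) +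
        wittPair (1 + HahnSeries.single (i : ℤ) (HahnSeries.single (j : ℤ) b))
          (HahnSeries.single (1 : ℤ) (1 : LaurentSeries k))
          (HahnSeries.single k₀ (HahnSeries.single l₀ c))
        = 0) := by
  refine ⟨?_, fun ⟨hk, hl⟩ => ?_⟩
  · rintro ⟨rfl, rfl⟩
    rw [wittPair_one_add_single_eq i j hj, wittPair_one_add_single_eq j i hi, mul_add]
  · rw [wittPair_one_add_single_eq_zero i j hj _ _ _ _ hl,
      wittPair_one_add_single_eq_zero j i hi _ _ _ _ hk, add_zero]
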